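/- arXiv:1410.5037 — 6 statements merged into one kernel-verified Lean document; each statement's English description precedes it below -/
import Mathlib

section
/- Let 𝒜 be a collection of generalized atoms each of which is closed under substructures, and let θ be a quantifier-free formula of FO(𝒜). For all structures 𝔄, teams X, and subsets B ⊆ A, if 𝔄 ⊨_X θ, then 𝔄↾B ⊨_{X↾B} θ, where 𝔄↾B is the induced substructure on B and X↾B = {s ∈ X : s(x) ∈ B for all x in the domain of X}. -/
/-- A relational signature: a type of relation symbols with arities. -/
structure Signature : Type 1 where
  Rel : Type
  arity : Rel → ℕ

/-- A relational structure over a signature. -/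
structure Struc (σ : Signature) : Type 1 where
  A : Type
  interp : (r : σ.Rel) → (Fin (σ.arity r) → A) → Prop

/-- A generalized atom of type `(ty 0, ..., ty (t-1))`, given by a generalized
quantifier `Q`: a class of structures `(A, B_1, ..., B_t)` with `B_j ⊆ A^{ty j}`. -/
structure GenAtom : Type 1 where
  t : ℕ
  ty : Fin t → ℕ
  Q : (A : Type) → ((j : Fin t) → Set (Fin (ty j) → A)) → Prop

/-- Formulas of `FO(𝒜)` in negation normal form. Variables are natural numbers;
`ga : ι → GenAtom` is the collection 𝒜 of generalized atoms. -/
inductive Fml (σ : Signature) {ι : Type} (ga : ι → GenAtom) : Type where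
  | rel (r : σ.Rel) (v : Fin (σ.arity r) → ℕ)
  | nrel (r : σ.Rel) (v : Fin (σ.arity r) → ℕ)
  | eq (m n : ℕ)
  | neq (m n : ℕ)
  | and (φ ψ : Fml σ ga)
  | or (φ ψ : Fml σ ga)
  | ex (x : ℕ) (φ : Fml σ ga)
  | all (x : ℕ) (φ : Fml σ ga)
  | atom (i : ι) (v : (j : Fin (ga i).t) → Fin ((ga i).ty j) → ℕ)

/-- The updated assignment `s[a/x]`. -/
def upd {A : Type} (s : ℕ → A) (x : ℕ) (a : A) : ℕ → A :=
  fun n => if n = x then a else s n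

/-- `rel(X, ȳ)`: the relation that a team `X` induces via a tuple `v` of variables. -/
def relOf {A : Type} (X : Set (ℕ → A)) {m : ℕ} (v : Fin m → ℕ) : Set (Fin m → A) :=
  (fun s => fun k => s (v k)) '' X

variable {σ : Signature} {ι : Type} {ga : ι → GenAtom}

/-- Lax team semantics for `FO(𝒜)`. A team is a set of assignments `ℕ → M.A`. -/
def TSat (M : Struc σ) : Fml σ ga → Set (ℕ → M.A) → Prop
  | .rel r v, X => ∀ s ∈ X, M.interp r (fun k => s (v k))
  | .nrel r v, X => ∀ s ∈ X, ¬ M.interp r (fun k => s (v k))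
  | .eq m n, X => ∀ s ∈ X, s m = s n
  | .neq m n, X => ∀ s ∈ X, s m ≠ s n
  | .and φ ψ, X => TSat M φ X ∧ TSat M ψ X
  | .or φ ψ, X => ∃ Y Z, X = Y ∪ Z ∧ TSat M φ Y ∧ TSat M ψ Z
  | .ex x φ, X => ∃ F : (ℕ → M.A) → Set M.A, (∀ s ∈ X, (F s).Nonempty) ∧
      TSat M φ {s' | ∃ s ∈ X, ∃ a ∈ F s, s' = upd s x a}
  | .all x φ, X => TSat M φ {s' | ∃ s ∈ X, ∃ a : M.A, s' = upd s x a}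
  | .atom i v, X => (ga i).Q M.A (fun j => relOf X (v j))

/-- The set of free variables of a formula. -/
def Fr : Fml σ ga → Set ℕ
  | .rel _ v => Set.range v
  | .nrel _ v => Set.range v
  | .eq m n => {m, n}
  | .neq m n => {m, n}
  | .and φ ψ => Fr φ ∪ Fr ψ
  | .or φ ψ => Fr φ ∪ Fr ψ
  | .ex x φ => Fr φ \ {x}
  | .all x φ => Fr φ \ {x}
  | .atom _ v => ⋃ j, Set.range (v j)

/-- The set of all variables occurring in a formula (free or bound). -/
def Vars : Fml σ ga → Set ℕ
  | .rel _ v => Set.range v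
  | .nrel _ v => Set.range v
  | .eq m n => {m, n}
  | .neq m n => {m, n}
  | .and φ ψ => Vars φ ∪ Vars ψ
  | .or φ ψ => Vars φ ∪ Vars ψ
  | .ex x φ => insert x (Vars φ)
  | .all x φ => insert x (Vars φ)
  | .atom _ v => ⋃ j, Set.range (v j)

/-- Truth of a sentence `φ` in a structure `M`: satisfaction by the team of all
assignments, which (for sentences, by locality) represents satisfaction by the
team `{∅}` containing only the empty assignment. -/
def TTrue (M : Struc σ) (φ : Fml σ ga) : Prop :=
  TSat M φ (Set.univ : Set (ℕ → M.A))

/-- The induced substructure `M↾B` on a subset `B` of the domain. -/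
def Struc.restrict {σ : Signature} (M : Struc σ) (B : Set M.A) : Struc σ :=
  ⟨B, fun r w => M.interp r (fun k => (w k : M.A))⟩

/-- The restriction `X↾B = {s ∈ X : s(x) ∈ B for all x}` of a team to a subset
`B` of the codomain, viewed as a team with codomain `B`. -/
def teamRestrict {A : Type} (X : Set (ℕ → A)) (B : Set A) : Set (ℕ → ↥B) :=
  {s : ℕ → ↥B | (fun n => (s n : A)) ∈ X}

/-- A generalized atom is closed under substructures if whenever
`M ⊨_X A_Q(ȳ₁,...,ȳ_t)` and `B ⊆ A`, then `M↾B ⊨_{X↾B} A_Q(ȳ₁,...,ȳ_t)`. -/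
def SubClosedAtom (G : GenAtom) : Prop :=
  ∀ (A : Type) (B : Set A) (X : Set (ℕ → A)) (v : (j : Fin G.t) → Fin (G.ty j) → ℕ),
    G.Q A (fun j => relOf X (v j)) → G.Q ↥B (fun j => relOf (teamRestrict X B) (v j))

/-- Quantifier-free formulas. -/
def QFree : Fml σ ga → Prop
  | .rel _ _ => True
  | .nrel _ _ => True
  | .eq _ _ => True
  | .neq _ _ => True
  | .and φ ψ => QFree φ ∧ QFree ψ
  | .or φ ψ => QFree φ ∧ QFree ψ
  | .ex _ _ => False
  | .all _ _ => False
  | .atom _ _ => True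

/-- Lemma 13(1) of the paper, quantifier-free case: if every
generalized atom in the collection `ga` is closed under substructures and `θ`
is quantifier-free, then `M ⊨_X θ` implies `M↾B ⊨_{X↾B} θ` for every `B ⊆ A`. -/
theorem qfree_closed_under_substructures (σ : Signature) (ι : Type)
    (ga : ι → GenAtom) (hga : ∀ i, SubClosedAtom (ga i))
    (θ : Fml σ ga) (hθ : QFree θ)
    (M : Struc σ) (hA : Nonempty M.A) (B : Set M.A) (X : Set (ℕ → M.A))
    (h : TSat M θ X) :
    TSat (M.restrict B) θ (teamRestrict X B) := by
  induction θ generalizing X with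
  | rel r v => exact fun s hs => h _ hs
  | nrel r v => exact fun s hs => h _ hs
  | eq m n => exact fun s hs => Subtype.ext (h _ hs)
  | neq m n => exact fun s hs e => h _ hs (congrArg Subtype.val e)
  | and φ ψ ihφ ihψ => exact ⟨ihφ hθ.1 X h.1, ihψ hθ.2 X h.2⟩
  | or φ ψ ihφ ihψ =>
    obtain ⟨Y, Z, rfl, hY, hZ⟩ := h
    exact ⟨teamRestrict Y B, teamRestrict Z B, rfl, ihφ hθ.1 Y hY, ihψ hθ.2 Z hZ⟩
  | ex x φ _ => exact hθ.elim
  | all x φ _ => exact hθ.elim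
  | atom i v => exact hga i M.A B X v h
end

section
/- Let 𝒜 be a collection of generalized atoms each of which is closed under substructures, and let φ = ∀y_0⋯∀y_m θ be a formula of FO(𝒜) with θ quantifier-free. Then φ is closed under substructures: for all structures 𝔄, teams X, and nonempty subsets B ⊆ A, if 𝔄 ⊨_X φ then 𝔄↾B ⊨_{X↾B} φ. -/
variable {σ : Signature} {ι : Type} {ga : ι → GenAtom}

/-- The second team is a subteam of `X↾B`, and all of `X↾B` when `B` is the whole domain. -/
def IsRestrictedSubteam {A : Type} (B : Set A) (X : Set (ℕ → A)) (X' : Set (ℕ → ↥B)) : Prop :=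
  X' ⊆ teamRestrict X B ∧ (B = Set.univ → X' = teamRestrict X B)

/-- Evaluating a tuple of variables avoiding `n` is unaffected by updating `n`. -/
lemma upd_comp_of_ne {A : Type} {m : ℕ} {v : Fin m → ℕ} {n : ℕ} (hn : ∀ k, v k ≠ n)
    (s : ℕ → A) (a : A) : (fun k => upd s n a (v k)) = fun k => s (v k) := by
  funext k
  simp [upd, hn k]

lemma coe_upd {A : Type} {B : Set A} (s : ℕ → ↥B) (n : ℕ) (b : ↥B) :
    (fun k => ((upd s n b : ℕ → ↥B) k : A)) = upd (fun k => (s k : A)) n b := by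
  funext k
  simp only [upd]
  split_ifs <;> rfl

lemma exists_fresh {t : ℕ} {ty : Fin t → ℕ} (v : (j : Fin t) → Fin (ty j) → ℕ) :
    ∃ n, ∀ j k, v j k ≠ n := by
  obtain ⟨n, hn⟩ := (Set.finite_range fun p : (j : Fin t) × Fin (ty j) => v p.1 p.2).exists_notMem
  exact ⟨n, fun j k h => hn ⟨⟨j, k⟩, h⟩⟩

/-- The restriction in `SubClosedAtom` constrains all variables, also those not occurring in the
atom. Marking assignments at a fresh variable with an element outside of `B` removes them from the
restricted team, so a substructure-closed atom passes to arbitrary subteams of `X↾B`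
whenever `B` is a proper subset. -/
lemma SubClosedAtom.subteam {G : GenAtom} (hG : SubClosedAtom G) {A : Type} {B : Set A}
    (hB : B.Nonempty) {X : Set (ℕ → A)} {X' : Set (ℕ → ↥B)} (hX : IsRestrictedSubteam B X X')
    (v : (j : Fin G.t) → Fin (G.ty j) → ℕ) (h : G.Q A fun j => relOf X (v j)) :
    G.Q ↥B fun j => relOf X' (v j) := by
  by_cases hU : B = Set.univ
  · rw [hX.2 hU]
    exact hG A B X v h
  obtain ⟨a, ha⟩ := (Set.ne_univ_iff_exists_notMem B).1 hU
  obtain ⟨b, hb⟩ := hB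
  obtain ⟨n, hn⟩ := exists_fresh v
  let Y : Set (ℕ → A) :=
    {s | (∃ s₀ ∈ X', s = fun k => ((upd s₀ n ⟨b, hb⟩ : ℕ → ↥B) k : A)) ∨ ∃ s₀ ∈ X, s = upd s₀ n a}
  have hY : (fun j => relOf Y (v j)) = fun j => relOf X (v j) := by
    funext j
    apply Set.Subset.antisymm
    · rintro _ ⟨_, ⟨s, hs, rfl⟩ | ⟨s, hs, rfl⟩, rfl⟩
      · refine ⟨_, hX.1 hs, ?_⟩
        rw [coe_upd]
        exact (upd_comp_of_ne (hn j) (fun k => (s k : A)) b).symm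
      · exact ⟨s, hs, (upd_comp_of_ne (hn j) _ _).symm⟩
    · rintro _ ⟨s, hs, rfl⟩
      exact ⟨_, Or.inr ⟨s, hs, rfl⟩, upd_comp_of_ne (hn j) _ _⟩
  have hY' : (fun j => relOf (teamRestrict Y B) (v j)) = fun j => relOf X' (v j) := by
    funext j
    apply Set.Subset.antisymm
    · rintro _ ⟨s, ⟨s₀, hs₀, hs⟩ | ⟨s₀, -, hs⟩, rfl⟩
      · refine ⟨s₀, hs₀, ?_⟩
        have : s = upd s₀ n ⟨b, hb⟩ := funext fun k => Subtype.ext (congrFun hs k)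
        rw [this]
        exact (upd_comp_of_ne (hn j) _ _).symm
      · have hsn : (s n : A) = a := by simpa [upd] using congrFun hs n
        exact absurd (hsn ▸ (s n).2) ha
    · rintro _ ⟨s, hs, rfl⟩
      exact ⟨_, Or.inl ⟨s, hs, rfl⟩, upd_comp_of_ne (hn j) _ _⟩
  rw [← hY']
  exact hG A B Y v (hY ▸ h)

lemma IsRestrictedSubteam.inter {A : Type} {B : Set A} {X Y : Set (ℕ → A)} {X' : Set (ℕ → ↥B)}
    (hX : IsRestrictedSubteam B X X') (hY : Y ⊆ X) :
    IsRestrictedSubteam B Y (X' ∩ teamRestrict Y B) := by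
  refine ⟨Set.inter_subset_right, fun hU => ?_⟩
  rw [hX.2 hU]
  exact Set.inter_eq_right.2 fun s hs => hY hs

lemma IsRestrictedSubteam.all {A : Type} {B : Set A} {X : Set (ℕ → A)} {X' : Set (ℕ → ↥B)}
    (hX : IsRestrictedSubteam B X X') (x : ℕ) :
    IsRestrictedSubteam B {s | ∃ s₀ ∈ X, ∃ a : A, s = upd s₀ x a}
      {s | ∃ s₀ ∈ X', ∃ b : ↥B, s = upd s₀ x b} := by
  have hsub : {s | ∃ s₀ ∈ X', ∃ b : ↥B, s = upd s₀ x b} ⊆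
      teamRestrict {s | ∃ s₀ ∈ X, ∃ a : A, s = upd s₀ x a} B := by
    rintro _ ⟨s, hs, b, rfl⟩
    exact ⟨_, hX.1 hs, b, coe_upd s x b⟩
  refine ⟨hsub, fun hU => hsub.antisymm ?_⟩
  rintro s ⟨s₀, hs₀, a, hs⟩
  have hmem : ∀ c : A, c ∈ B := fun c => hU ▸ Set.mem_univ c
  refine ⟨fun k => ⟨s₀ k, hmem _⟩, ?_, ⟨a, hmem a⟩, ?_⟩
  · rw [hX.2 hU]
    exact hs₀
  · funext k
    apply Subtype.ext
    have := congrFun hs k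
    simp only [upd] at this ⊢
    split_ifs at this ⊢ <;> exact this

/-- Quantifier-free formulas pass to restricted subteams. -/
lemma QFree.tsat_restrict (hga : ∀ i, SubClosedAtom (ga i)) {M : Struc σ} {B : Set M.A}
    (hB : B.Nonempty) {θ : Fml σ ga} (hθ : QFree θ) {X : Set (ℕ → M.A)} {X' : Set (ℕ → ↥B)}
    (hX : IsRestrictedSubteam B X X') (h : TSat M θ X) : TSat (M.restrict B) θ X' := by
  induction θ generalizing X X' with
  | rel r v => exact fun s hs => h _ (hX.1 hs)
  | nrel r v => exact fun s hs => h _ (hX.1 hs)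
  | eq m n => exact fun s hs => Subtype.ext (h _ (hX.1 hs))
  | neq m n => exact fun s hs hmn => h _ (hX.1 hs) (congrArg Subtype.val hmn)
  | and φ ψ ihφ ihψ => exact ⟨ihφ hθ.1 hX h.1, ihψ hθ.2 hX h.2⟩
  | or φ ψ ihφ ihψ =>
    obtain ⟨Y, Z, rfl, hY, hZ⟩ := h
    refine ⟨X' ∩ teamRestrict Y B, X' ∩ teamRestrict Z B, ?_,
      ihφ hθ.1 (hX.inter Set.subset_union_left) hY,
      ihψ hθ.2 (hX.inter Set.subset_union_right) hZ⟩
    exact (Set.inter_eq_left.2 hX.1).symm.trans (Set.inter_union_distrib_left X' _ _)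
  | ex x φ => exact hθ.elim
  | all x φ => exact hθ.elim
  | atom i v => exact (hga i).subteam hB hX v h

/-- Universal formulas pass to restricted subteams. -/
lemma QFree.tsat_restrict_foldr_all (hga : ∀ i, SubClosedAtom (ga i)) {M : Struc σ} {B : Set M.A}
    (hB : B.Nonempty) {θ : Fml σ ga} (hθ : QFree θ) (ys : List ℕ) {X : Set (ℕ → M.A)}
    {X' : Set (ℕ → ↥B)} (hX : IsRestrictedSubteam B X X') (h : TSat M (ys.foldr Fml.all θ) X) :
    TSat (M.restrict B) (ys.foldr Fml.all θ) X' := by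
  induction ys generalizing X X' with
  | nil => exact hθ.tsat_restrict hga hB hX h
  | cons y ys ih => exact ih (hX.all y) h

/-- Lemma 13(1) of the paper: if every generalized atom in
the collection `ga` is closed under substructures, `θ` is quantifier-free and
`φ = ∀y₀⋯∀y_m θ`, then `φ` is closed under substructures: `M ⊨_X φ` implies
`M↾B ⊨_{X↾B} φ` for every nonempty `B ⊆ A`. -/
theorem universal_closed_under_substructures (σ : Signature) (ι : Type)
    (ga : ι → GenAtom) (hga : ∀ i, SubClosedAtom (ga i))
    (θ : Fml σ ga) (hθ : QFree θ) (ys : List ℕ)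
    (φ : Fml σ ga) (hφ : φ = ys.foldr Fml.all θ)
    (M : Struc σ) (hA : Nonempty M.A) (B : Set M.A) (hB : B.Nonempty)
    (X : Set (ℕ → M.A)) (h : TSat M φ X) :
    TSat (M.restrict B) φ (teamRestrict X B) := by
  subst hφ
  exact hθ.tsat_restrict_foldr_all hga hB ys ⟨Set.Subset.rfl, fun _ => rfl⟩ h
end

section
/- Small model property for ∃*∀*: let 𝒜 be a collection of generalized atoms closed under substructures and let φ = ∃x_0⋯∃x_n ∀y_0⋯∀y_m θ be a sentence of FO(𝒜) with θ quantifier-free. If φ is satisfiable (some structure 𝔄 satisfies 𝔄 ⊨ φ), then φ has a model whose domain has cardinality at most max{1, n+1} (i.e., at most the number of existentially quantified variables, or 1 if there are none). -/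
variable {σ : Signature} {ι : Type} {ga : ι → GenAtom}

theorem tSat_foldr_ex_iff (M : Struc σ) (ψ : Fml σ ga) (xs : List ℕ) (X : Set (ℕ → M.A)) :
    TSat M (xs.foldr Fml.ex ψ) X ↔ ∃ Y : Set (ℕ → M.A), TSat M ψ Y ∧
      (∀ s ∈ X, ∃ t ∈ Y, ∀ n ∉ xs, t n = s n) ∧ (∀ t ∈ Y, ∃ s ∈ X, ∀ n ∉ xs, t n = s n) := by
  induction xs generalizing X with
  | nil =>
    constructor
    · intro h
      exact ⟨X, h, fun s hs => ⟨s, hs, fun _ _ => rfl⟩, fun s hs => ⟨s, hs, fun _ _ => rfl⟩⟩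
    · rintro ⟨Y, h, hXY, hYX⟩
      have : X = Y := by
        ext s
        constructor
        · intro hs
          obtain ⟨t, ht, e⟩ := hXY s hs
          rwa [← funext fun n => e n List.not_mem_nil]
        · intro hs
          obtain ⟨t, ht, e⟩ := hYX s hs
          rwa [funext fun n => e n List.not_mem_nil]
      exact this ▸ h
  | cons x xs ih =>
    simp only [List.foldr_cons, TSat, ih]
    constructor
    · rintro ⟨F, hF, Y, hY, h1, h2⟩
      refine ⟨Y, hY, fun s hs => ?_, fun t ht => ?_⟩
      · obtain ⟨a, ha⟩ := hF s hs
        obtain ⟨t, ht, e⟩ := h1 _ ⟨s, hs, a, ha, rfl⟩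
        refine ⟨t, ht, fun n hn => ?_⟩
        rw [List.mem_cons, not_or] at hn
        simp [e n hn.2, upd, hn.1]
      · obtain ⟨_, ⟨s, hs, a, -, rfl⟩, e⟩ := h2 t ht
        refine ⟨s, hs, fun n hn => ?_⟩
        rw [List.mem_cons, not_or] at hn
        simp [e n hn.2, upd, hn.1]
    · rintro ⟨Y, hY, h1, h2⟩
      have key : ∀ s t : ℕ → M.A, (∀ n ∉ x :: xs, t n = s n) →
          ∀ n ∉ xs, t n = upd s x (t x) n := by
        intro s t e n hn
        by_cases hx : n = x
        · simp [upd, hx]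
        · simp [upd, hx, e n (by simp [hx, hn])]
      refine ⟨fun s => {a | ∃ t ∈ Y, ∀ n ∉ xs, t n = upd s x a n}, fun s hs => ?_,
        Y, hY, ?_, fun t ht => ?_⟩
      · obtain ⟨t, ht, e⟩ := h1 s hs
        exact ⟨t x, t, ht, key s t e⟩
      · rintro _ ⟨s, -, a, ha, rfl⟩
        exact ha
      · obtain ⟨s, hs, e⟩ := h2 t ht
        exact ⟨_, ⟨s, hs, t x, ⟨t, ht, key s t e⟩, rfl⟩, key s t e⟩

theorem tSat_foldr_all_iff (M : Struc σ) (ψ : Fml σ ga) (ys : List ℕ) (X : Set (ℕ → M.A)) :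
    TSat M (ys.foldr Fml.all ψ) X ↔ TSat M ψ {t | ∃ s ∈ X, ∀ n ∉ ys, t n = s n} := by
  induction ys generalizing X with
  | nil =>
    have : X = {t | ∃ s ∈ X, ∀ n ∉ ([] : List ℕ), t n = s n} := by
      ext t
      simp [← funext_iff]
    exact iff_of_eq (congrArg (TSat M ψ) this)
  | cons y ys ih =>
    simp only [List.foldr_cons, TSat, ih]
    refine iff_of_eq (congrArg (TSat M ψ) ?_)
    ext t
    constructor
    · rintro ⟨_, ⟨s, hs, a, rfl⟩, e⟩
      refine ⟨s, hs, fun n hn => ?_⟩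
      rw [List.mem_cons, not_or] at hn
      simp [e n hn.2, upd, hn.1]
    · rintro ⟨s, hs, e⟩
      refine ⟨_, ⟨s, hs, t y, rfl⟩, fun n hn => ?_⟩
      by_cases hy : n = y
      · simp [upd, hy]
      · simp [upd, hy, e n (by simp [hy, hn])]

theorem fr_subset_foldr_ex (ψ : Fml σ ga) (xs : List ℕ) :
    Fr ψ ⊆ Fr (xs.foldr Fml.ex ψ) ∪ {n | n ∈ xs} := by
  induction xs with
  | nil => simp
  | cons x xs ih =>
    intro n hn
    have := ih hn
    simp only [List.foldr_cons, Fr, Set.mem_union, Set.mem_ofPred_eq, Set.mem_sdiff,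
      Set.mem_singleton_iff, List.mem_cons] at this ⊢
    tauto

theorem fr_subset_foldr_all (ψ : Fml σ ga) (ys : List ℕ) :
    Fr ψ ⊆ Fr (ys.foldr Fml.all ψ) ∪ {n | n ∈ ys} := by
  induction ys with
  | nil => simp
  | cons y ys ih =>
    intro n hn
    have := ih hn
    simp only [List.foldr_cons, Fr, Set.mem_union, Set.mem_ofPred_eq, Set.mem_sdiff,
      Set.mem_singleton_iff, List.mem_cons] at this ⊢
    tauto

/-- Quantifier-free formulas are preserved when passing to a substructure, the new team being,
on a set `V` containing the free variables, the part of the old team with values in `B`. -/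
theorem TSat.restrict_of_qFree (hga : ∀ i, SubClosedAtom (ga i)) (M : Struc σ) (B : Set M.A)
    (hB : B.Nonempty) (V : Set ℕ) (θ : Fml σ ga) (hθ : QFree θ) (hV : Fr θ ⊆ V)
    (X : Set (ℕ → M.A)) (X' : Set (ℕ → B))
    (hX' : ∀ t ∈ X', ∃ s ∈ X, ∀ n ∈ V, s n = t n)
    (hX : ∀ s ∈ X, (∀ n ∈ V, s n ∈ B) → ∃ t ∈ X', ∀ n ∈ V, s n = t n)
    (h : TSat M θ X) : TSat (M.restrict B) θ X' := by
  induction θ generalizing X X' with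
  | rel r v =>
    intro t ht
    obtain ⟨s, hs, e⟩ := hX' t ht
    have := h s hs
    simp only [fun k => e (v k) (hV ⟨k, rfl⟩)] at this
    exact this
  | nrel r v =>
    intro t ht
    obtain ⟨s, hs, e⟩ := hX' t ht
    have := h s hs
    simp only [fun k => e (v k) (hV ⟨k, rfl⟩)] at this
    exact this
  | eq m n =>
    intro t ht
    obtain ⟨s, hs, e⟩ := hX' t ht
    have := h s hs
    rw [e m (hV (Or.inl rfl)), e n (hV (Or.inr rfl))] at this
    exact Subtype.ext this
  | neq m n =>
    intro t ht
    obtain ⟨s, hs, e⟩ := hX' t ht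
    have := h s hs
    rw [e m (hV (Or.inl rfl)), e n (hV (Or.inr rfl))] at this
    exact fun hmn => this (congrArg Subtype.val hmn)
  | and φ ψ ihφ ihψ =>
    exact ⟨ihφ hθ.1 (Set.subset_union_left.trans hV) X X' hX' hX h.1,
      ihψ hθ.2 (Set.subset_union_right.trans hV) X X' hX' hX h.2⟩
  | or φ ψ ihφ ihψ =>
    obtain ⟨Y, Z, rfl, hY, hZ⟩ := h
    refine ⟨{t : ℕ → B | t ∈ X' ∧ ∃ s ∈ Y, ∀ n ∈ V, s n = t n},
      {t : ℕ → B | t ∈ X' ∧ ∃ s ∈ Z, ∀ n ∈ V, s n = t n},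
      ?_, ihφ hθ.1 (Set.subset_union_left.trans hV) Y _ (fun t ht => ht.2) ?_ hY,
      ihψ hθ.2 (Set.subset_union_right.trans hV) Z _ (fun t ht => ht.2) ?_ hZ⟩
    · ext t
      constructor
      · intro ht
        obtain ⟨s, hs | hs, e⟩ := hX' t ht
        · exact Or.inl ⟨ht, s, hs, e⟩
        · exact Or.inr ⟨ht, s, hs, e⟩
      · rintro (ht | ht) <;> exact ht.1
    · intro s hs hsB
      obtain ⟨t, ht, e⟩ := hX s (Or.inl hs) hsB
      exact ⟨t, ⟨ht, s, hs, e⟩, e⟩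
    · intro s hs hsB
      obtain ⟨t, ht, e⟩ := hX s (Or.inr hs) hsB
      exact ⟨t, ⟨ht, s, hs, e⟩, e⟩
  | ex x φ => exact hθ.elim
  | all x φ => exact hθ.elim
  | atom i v =>
    classical
    obtain ⟨b, hb⟩ := hB
    have hv : ∀ j k, v j k ∈ V := fun j k => hV (Set.mem_iUnion.2 ⟨j, k, rfl⟩)
    let clip : (ℕ → M.A) → ℕ → M.A := fun s n => if n ∈ V then s n else b
    have hclip : ∀ s n, n ∈ V → clip s n = s n := fun s n hn => if_pos hn
    have e₁ : (fun j => relOf X (v j)) = fun j => relOf (clip '' X) (v j) := by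
      funext j
      simp only [relOf, Set.image_image, hclip _ _ (hv j _)]
    have e₂ : (fun j => relOf (teamRestrict (clip '' X) B) (v j)) = fun j => relOf X' (v j) := by
      funext j
      ext w
      constructor
      · rintro ⟨t, ⟨s, hs, e⟩, rfl⟩
        have hst : ∀ n ∈ V, s n = t n := fun n hn => (hclip s n hn).symm.trans (congrFun e n)
        obtain ⟨t', ht', e'⟩ := hX s hs fun n hn => hst n hn ▸ (t n).2
        exact ⟨t', ht', funext fun k =>
          Subtype.ext ((e' _ (hv j k)).symm.trans (hst _ (hv j k)))⟩
      · rintro ⟨t, ht, rfl⟩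
        obtain ⟨s, hs, e⟩ := hX' t ht
        have hsB : ∀ n, clip s n ∈ B := by
          intro n
          by_cases hn : n ∈ V
          · rw [hclip s n hn, e n hn]
            exact (t n).2
          · simpa [clip, hn] using hb
        exact ⟨fun n => ⟨clip s n, hsB n⟩, ⟨s, hs, rfl⟩, funext fun k =>
          Subtype.ext ((hclip s _ (hv j k)).trans (e _ (hv j k)))⟩
    change (ga i).Q M.A (fun j => relOf X (v j)) at h
    change (ga i).Q B (fun j => relOf X' (v j))
    rw [e₁] at h
    rw [← e₂]
    exact hga i M.A B (clip '' X) v h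

theorem exists_small_set_of_list {A : Type} (s : ℕ → A) (xs : List ℕ) :
    ∃ B : Set A, B.Nonempty ∧ Finite B ∧ Nat.card B ≤ max 1 xs.length ∧ ∀ x ∈ xs, s x ∈ B := by
  classical
  have key : ∀ l : List ℕ, l ≠ [] → ∃ B : Set A, B.Nonempty ∧ Finite B ∧
      Nat.card B ≤ l.length ∧ ∀ x ∈ l, s x ∈ B := by
    intro l hl
    refine ⟨↑(l.map s).toFinset, ?_, Finset.finite_toSet _, ?_, fun x hx => ?_⟩
    · obtain ⟨x, hx⟩ := List.exists_mem_of_ne_nil l hl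
      exact ⟨s x, by simpa using ⟨x, hx, rfl⟩⟩
    · rw [Nat.card_coe_set_eq, Set.ncard_coe_finset]
      exact (List.toFinset_card_le _).trans (by simp)
    · simpa using ⟨x, hx, rfl⟩
  by_cases hxs : xs = []
  · obtain ⟨B, h₁, h₂, h₃, -⟩ := key [0] (by simp)
    exact ⟨B, h₁, h₂, by simpa [hxs] using h₃, by simp [hxs]⟩
  · obtain ⟨B, h₁, h₂, h₃, h₄⟩ := key xs hxs
    exact ⟨B, h₁, h₂, h₃.trans (le_max_right _ _), h₄⟩

/-- Lemma 13(2) of the paper, small model property for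
`∃*∀*`: if every generalized atom in the collection `ga` is closed under
substructures and the sentence `φ = ∃x₀⋯∃x_n ∀y₀⋯∀y_m θ` (with `θ`
quantifier-free) is satisfiable, then `φ` has a model with at most
`max 1 k` elements, where `k` is the number of existentially quantified
variables of `φ`. -/
theorem exists_forall_small_model (σ : Signature) (ι : Type)
    (ga : ι → GenAtom) (hga : ∀ i, SubClosedAtom (ga i))
    (θ : Fml σ ga) (hθ : QFree θ) (xs ys : List ℕ)
    (φ : Fml σ ga) (hφ : φ = xs.foldr Fml.ex (ys.foldr Fml.all θ))
    (hsen : Fr φ = ∅)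
    (hsat : ∃ M : Struc σ, Nonempty M.A ∧ TTrue M φ) :
    ∃ M : Struc σ, Nonempty M.A ∧ Finite M.A ∧
      Nat.card M.A ≤ max 1 xs.length ∧ TTrue M φ := by
  classical
  subst hφ
  obtain ⟨M, ⟨a⟩, hM⟩ := hsat
  obtain ⟨Y, hY, hY₁, -⟩ := (tSat_foldr_ex_iff M _ xs _).1 hM
  rw [tSat_foldr_all_iff] at hY
  obtain ⟨s₀, hs₀, -⟩ := hY₁ (fun _ => a) trivial
  obtain ⟨B, hB, hfin, hcard, hsB⟩ := exists_small_set_of_list s₀ xs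
  have hV : Fr θ ⊆ {n | n ∈ xs ∨ n ∈ ys} := by
    intro n hn
    rcases fr_subset_foldr_all θ ys hn with h | h
    · rcases fr_subset_foldr_ex _ xs h with h | h
      · simp [hsen] at h
      · exact Or.inl h
    · exact Or.inr h
  refine ⟨M.restrict B, hB.to_subtype, hfin, hcard,
    (tSat_foldr_ex_iff _ _ xs _).2 ⟨{t : ℕ → B | ∃ s ∈ Y, ∀ n ∈ xs, n ∉ ys → s n = t n},
      (tSat_foldr_all_iff _ _ ys _).2 ?_, fun u _ => ?_, fun t _ => ⟨t, trivial, fun _ _ => rfl⟩⟩⟩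
  · refine TSat.restrict_of_qFree hga M B hB _ θ hθ hV _ _ ?_ ?_ hY
    · rintro t ⟨t₁, ⟨s, hs, e₁⟩, e⟩
      refine ⟨fun n => if n ∈ ys then t n else s n, ⟨s, hs, fun n hn => if_neg hn⟩, fun n hn => ?_⟩
      by_cases hy : n ∈ ys
      · simp [hy]
      · simp only [hy, if_false]
        rw [e n hy]
        exact e₁ n (hn.resolve_right hy) hy
    · rintro s ⟨s₁, hs₁, e⟩ hs
      obtain ⟨b, hb⟩ := hB
      let t : ℕ → B := fun n => if hn : n ∈ xs ∨ n ∈ ys then ⟨s n, hs n hn⟩ else ⟨b, hb⟩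
      have ht : ∀ n, n ∈ xs ∨ n ∈ ys → s n = t n := fun n hn => by simp only [t, dif_pos hn]
      exact ⟨t, ⟨t, ⟨s₁, hs₁, fun n hx hy => (e n hy).symm.trans (ht n (Or.inl hx))⟩,
        fun _ _ => rfl⟩, ht⟩
  · let t : ℕ → B := fun n => if hn : n ∈ xs then ⟨s₀ n, hsB n hn⟩ else u n
    refine ⟨t, ⟨s₀, hs₀, fun n hn _ => ?_⟩, fun n hn => dif_neg hn⟩
    exact (congrArg Subtype.val (dif_pos hn : t n = ⟨s₀ n, hsB n hn⟩)).symm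
end

section
/- Finite model property: let 𝒜 be a collection of generalized atoms closed under substructures and let φ be a sentence of FO(𝒜) of the form ∃x_0⋯∃x_n ∀y_0⋯∀y_m θ with θ quantifier-free. Then φ is satisfiable if and only if φ has a finite model. -/
variable {σ : Signature} {ι : Type} {ga : ι → GenAtom}

open Set

/-- Every assignment in `X` agrees on `V` with one in `Y`, and conversely. -/
def TeamEqOn {A : Type} (V : Set ℕ) (X Y : Set (ℕ → A)) : Prop :=
  (∀ s ∈ X, ∃ t ∈ Y, EqOn s t V) ∧ ∀ t ∈ Y, ∃ s ∈ X, EqOn s t V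

theorem TeamEqOn.mono {A : Type} {V W : Set ℕ} {X Y : Set (ℕ → A)} (h : TeamEqOn W X Y)
    (hVW : V ⊆ W) : TeamEqOn V X Y :=
  ⟨fun s hs => (h.1 s hs).imp fun _ ht => ⟨ht.1, ht.2.mono hVW⟩,
    fun t ht => (h.2 t ht).imp fun _ hs => ⟨hs.1, hs.2.mono hVW⟩⟩

theorem TeamEqOn.relOf_eq {A : Type} {V : Set ℕ} {X Y : Set (ℕ → A)} (h : TeamEqOn V X Y)
    {m : ℕ} {v : Fin m → ℕ} (hv : range v ⊆ V) : relOf X v = relOf Y v := by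
  ext w
  constructor
  · rintro ⟨s, hs, rfl⟩
    obtain ⟨t, ht, hst⟩ := h.1 s hs
    exact ⟨t, ht, funext fun k => (hst (hv ⟨k, rfl⟩)).symm⟩
  · rintro ⟨t, ht, rfl⟩
    obtain ⟨s, hs, hst⟩ := h.2 t ht
    exact ⟨s, hs, funext fun k => hst (hv ⟨k, rfl⟩)⟩

/-- If `X` and `Y` agree on `V`, a subteam of `X` agrees on `V` with the subteam of `Y` consisting
of the matching assignments. -/
theorem TeamEqOn.subteam {A : Type} {V : Set ℕ} {X Y X' : Set (ℕ → A)} (h : TeamEqOn V X Y)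
    (hX' : X' ⊆ X) : TeamEqOn V X' {t ∈ Y | ∃ s ∈ X', EqOn s t V} :=
  ⟨fun s hs => by
    obtain ⟨t, ht, hst⟩ := h.1 s (hX' hs)
    exact ⟨t, ⟨ht, s, hs, hst⟩, hst⟩, fun _ ht => ht.2⟩

/-- Locality of quantifier-free formulas. -/
theorem TSat.congr_teamEqOn (M : Struc σ) {θ : Fml σ ga} (hθ : QFree θ) {X Y : Set (ℕ → M.A)}
    (h : TeamEqOn (Fr θ) X Y) (hX : TSat M θ X) : TSat M θ Y := by
  induction θ generalizing X Y with
  | rel r v =>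
    intro t ht
    obtain ⟨s, hs, hst⟩ := h.2 t ht
    have hv : (fun k => s (v k)) = fun k => t (v k) := funext fun k => hst ⟨k, rfl⟩
    exact hv ▸ hX s hs
  | nrel r v =>
    intro t ht
    obtain ⟨s, hs, hst⟩ := h.2 t ht
    have hv : (fun k => s (v k)) = fun k => t (v k) := funext fun k => hst ⟨k, rfl⟩
    exact hv ▸ hX s hs
  | eq m n =>
    intro t ht
    obtain ⟨s, hs, hst⟩ := h.2 t ht
    rw [← hst (Or.inl rfl), ← hst (Or.inr rfl)]
    exact hX s hs
  | neq m n =>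
    intro t ht
    obtain ⟨s, hs, hst⟩ := h.2 t ht
    rw [← hst (Or.inl rfl), ← hst (Or.inr rfl)]
    exact hX s hs
  | and φ ψ ihφ ihψ =>
    exact ⟨ihφ hθ.1 (h.mono subset_union_left) hX.1, ihψ hθ.2 (h.mono subset_union_right) hX.2⟩
  | or φ ψ ihφ ihψ =>
    obtain ⟨X₁, X₂, rfl, h₁, h₂⟩ := hX
    refine ⟨_, _, ?_, ihφ hθ.1 ((h.subteam subset_union_left).mono subset_union_left) h₁,
      ihψ hθ.2 ((h.subteam subset_union_right).mono subset_union_right) h₂⟩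
    ext t
    constructor
    · intro ht
      obtain ⟨s, hs, hst⟩ := h.2 t ht
      exact hs.imp (fun hs => ⟨ht, s, hs, hst⟩) fun hs => ⟨ht, s, hs, hst⟩
    · rintro (ht | ht) <;> exact ht.1
  | ex x φ => exact hθ.elim
  | all x φ => exact hθ.elim
  | atom i v =>
    have hv : (fun j => relOf X (v j)) = fun j => relOf Y (v j) :=
      funext fun j => h.relOf_eq (subset_iUnion (fun j => range (v j)) j)
    change (ga i).Q M.A _
    exact hv ▸ hX

theorem TSat.restrict (hga : ∀ i, SubClosedAtom (ga i)) (M : Struc σ) (B : Set M.A)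
    {θ : Fml σ ga} (hθ : QFree θ) {X : Set (ℕ → M.A)} (hX : TSat M θ X) :
    TSat (M.restrict B) θ (teamRestrict X B) := by
  induction θ generalizing X with
  | rel r v => exact fun s hs => hX _ hs
  | nrel r v => exact fun s hs => hX _ hs
  | eq m n => exact fun s hs => Subtype.ext (hX _ hs)
  | neq m n => exact fun s hs hmn => hX _ hs (congrArg Subtype.val hmn)
  | and φ ψ ihφ ihψ => exact ⟨ihφ hθ.1 hX.1, ihψ hθ.2 hX.2⟩
  | or φ ψ ihφ ihψ =>
    obtain ⟨X₁, X₂, rfl, h₁, h₂⟩ := hX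
    exact ⟨_, _, rfl, ihφ hθ.1 h₁, ihψ hθ.2 h₂⟩
  | ex x φ => exact hθ.elim
  | all x φ => exact hθ.elim
  | atom i v => exact hga i M.A B X v hX

theorem upd_self {A : Type} (s : ℕ → A) (x : ℕ) (a : A) : upd s x a x = a := if_pos rfl

theorem upd_of_ne {A : Type} (s : ℕ → A) {x n : ℕ} (a : A) (h : n ≠ x) : upd s x a n = s n :=
  if_neg h

theorem eqOn_upd_of_notMem_cons {A : Type} {s t : ℕ → A} {x : ℕ} {xs : List ℕ} {a : A}
    (h : EqOn (upd s x a) t {n | n ∉ xs}) : EqOn s t {n | n ∉ x :: xs} := fun n hn => by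
  obtain ⟨hnx, hn⟩ := List.ne_and_not_mem_of_not_mem_cons hn
  rw [← h hn, upd_of_ne s a hnx]

theorem eqOn_upd_apply {A : Type} {s t : ℕ → A} {x : ℕ} {xs : List ℕ}
    (h : EqOn s t {n | n ∉ x :: xs}) : EqOn (upd s x (t x)) t {n | n ∉ xs} := fun n hn => by
  by_cases hnx : n = x
  · rw [hnx, upd_self]
  · rw [upd_of_ne s _ hnx]
    exact h (List.not_mem_cons_of_ne_of_not_mem hnx hn)

theorem eq_of_eqOn_notMem_nil {A : Type} {s t : ℕ → A}
    (h : EqOn s t {n | n ∉ ([] : List ℕ)}) : s = t :=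
  funext fun _ => h List.not_mem_nil

theorem tSat_foldr_ex (M : Struc σ) (ψ : Fml σ ga) (xs : List ℕ) (X : Set (ℕ → M.A)) :
    TSat M (xs.foldr Fml.ex ψ) X ↔ ∃ W, TeamEqOn {n | n ∉ xs} X W ∧ TSat M ψ W := by
  induction xs generalizing X with
  | nil =>
    constructor
    · exact fun h =>
        ⟨X, ⟨fun s hs => ⟨s, hs, eqOn_refl s _⟩, fun s hs => ⟨s, hs, eqOn_refl s _⟩⟩, h⟩
    · rintro ⟨W, hW, h⟩
      have hXW : X = W := by
        ext s
        constructor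
        · intro hs
          obtain ⟨t, ht, hst⟩ := hW.1 s hs
          exact eq_of_eqOn_notMem_nil hst ▸ ht
        · intro hs
          obtain ⟨t, ht, hts⟩ := hW.2 s hs
          exact eq_of_eqOn_notMem_nil hts ▸ ht
      exact hXW ▸ h
  | cons x xs ih =>
    constructor
    · rintro ⟨F, hF, h⟩
      obtain ⟨W, hW, hψ⟩ := (ih _).1 h
      refine ⟨W, ⟨fun s hs => ?_, fun t ht => ?_⟩, hψ⟩
      · obtain ⟨a, ha⟩ := hF s hs
        obtain ⟨t, ht, hst⟩ := hW.1 _ ⟨s, hs, a, ha, rfl⟩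
        exact ⟨t, ht, eqOn_upd_of_notMem_cons hst⟩
      · obtain ⟨_, ⟨s, hs, a, ha, rfl⟩, hst⟩ := hW.2 t ht
        exact ⟨s, hs, eqOn_upd_of_notMem_cons hst⟩
    · rintro ⟨W, hW, hψ⟩
      refine ⟨fun s => {a | ∃ t ∈ W, EqOn (upd s x a) t {n | n ∉ xs}}, fun s hs => ?_,
        (ih _).2 ⟨W, ⟨?_, fun t ht => ?_⟩, hψ⟩⟩
      · obtain ⟨t, ht, hst⟩ := hW.1 s hs
        exact ⟨t x, t, ht, eqOn_upd_apply hst⟩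
      · rintro _ ⟨s, -, a, ha, rfl⟩
        exact ha
      · obtain ⟨s, hs, hst⟩ := hW.2 t ht
        exact ⟨_, ⟨s, hs, t x, ⟨t, ht, eqOn_upd_apply hst⟩, rfl⟩, eqOn_upd_apply hst⟩

theorem tSat_foldr_all (M : Struc σ) (ψ : Fml σ ga) (ys : List ℕ) (X : Set (ℕ → M.A)) :
    TSat M (ys.foldr Fml.all ψ) X ↔ TSat M ψ {t | ∃ s ∈ X, EqOn s t {n | n ∉ ys}} := by
  induction ys generalizing X with
  | nil =>
    have hX : {t | ∃ s ∈ X, EqOn s t {n | n ∉ ([] : List ℕ)}} = X := by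
      ext t
      constructor
      · rintro ⟨s, hs, hst⟩
        exact eq_of_eqOn_notMem_nil hst ▸ hs
      · exact fun ht => ⟨t, ht, fun _ _ => rfl⟩
    rw [hX, List.foldr_nil]
  | cons y ys ih =>
    refine (ih _).trans (iff_of_eq (congrArg _ ?_))
    ext t
    constructor
    · rintro ⟨_, ⟨s, hs, a, rfl⟩, hst⟩
      exact ⟨s, hs, eqOn_upd_of_notMem_cons hst⟩
    · rintro ⟨s, hs, hst⟩
      exact ⟨_, ⟨s, hs, t y, rfl⟩, eqOn_upd_apply hst⟩

theorem fr_subset_of_foldr_ex {ψ : Fml σ ga} (xs : List ℕ) :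
    Fr ψ ⊆ Fr (xs.foldr Fml.ex ψ) ∪ {n | n ∈ xs} := by
  induction xs with
  | nil => exact subset_union_left
  | cons x xs ih =>
    intro n hn
    by_cases hnx : n = x
    · exact Or.inr (hnx ▸ List.mem_cons_self)
    · exact (ih hn).imp (fun h => ⟨h, hnx⟩) (List.mem_cons_of_mem _)

theorem fr_subset_of_foldr_all {ψ : Fml σ ga} (ys : List ℕ) :
    Fr ψ ⊆ Fr (ys.foldr Fml.all ψ) ∪ {n | n ∈ ys} := by
  induction ys with
  | nil => exact subset_union_left
  | cons y ys ih =>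
    intro n hn
    by_cases hny : n = y
    · exact Or.inr (hny ▸ List.mem_cons_self)
    · exact (ih hn).imp (fun h => ⟨h, hny⟩) (List.mem_cons_of_mem _)

/-- finite model property for `∃*∀*`: if every generalized
atom in the collection `ga` is closed under substructures and
`φ = ∃x₀⋯∃x_n ∀y₀⋯∀y_m θ` is a sentence with `θ` quantifier-free, then `φ` is
satisfiable iff `φ` has a finite model. -/
theorem exists_forall_finite_model_property (σ : Signature) (ι : Type)
    (ga : ι → GenAtom) (hga : ∀ i, SubClosedAtom (ga i))
    (θ : Fml σ ga) (hθ : QFree θ) (xs ys : List ℕ)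
    (φ : Fml σ ga) (hφ : φ = xs.foldr Fml.ex (ys.foldr Fml.all θ))
    (hsen : Fr φ = ∅) :
    (∃ M : Struc σ, Nonempty M.A ∧ TTrue M φ) ↔
    (∃ M : Struc σ, Nonempty M.A ∧ Finite M.A ∧ TTrue M φ) := by
  refine ⟨?_, fun ⟨M, hM, _, h⟩ => ⟨M, hM, h⟩⟩
  rintro ⟨M, ⟨a⟩, h⟩
  subst hφ
  have hFr : Fr θ ⊆ {n | n ∈ xs ∨ n ∈ ys} := fun n hn =>
    (fr_subset_of_foldr_all ys hn).elim
      (fun h' => Or.inl ((fr_subset_of_foldr_ex xs h').resolve_left (hsen ▸ notMem_empty n)))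
      Or.inr
  obtain ⟨W, hW, hθW⟩ := (tSat_foldr_ex M _ xs _).1 h
  rw [tSat_foldr_all] at hθW
  obtain ⟨w, hw, -⟩ := hW.1 (fun _ => a) (mem_univ _)
  let B : Set M.A := insert a (w '' {n | n ∈ xs})
  have hB : B.Finite := ((List.finite_toSet xs).image w).insert a
  let X : Set (ℕ → M.A) := {s | ∃ t ∈ W, EqOn t s {n | n ∈ xs ∧ n ∉ ys}}
  have hθX : TSat M θ X := by
    refine TSat.congr_teamEqOn M hθ ⟨?_, ?_⟩ hθW
    · rintro s ⟨t, ht, hts⟩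
      exact ⟨s, ⟨t, ht, fun n hn => hts hn.2⟩, fun _ _ => rfl⟩
    · rintro s ⟨t, ht, hts⟩
      classical
      refine ⟨fun n => if n ∈ ys then s n else t n, ⟨t, ht, fun n hn => (if_neg hn).symm⟩,
        fun n hn => ?_⟩
      by_cases hny : n ∈ ys
      · exact if_pos hny
      · exact (if_neg hny).trans (hts ⟨(hFr hn).resolve_right hny, hny⟩)
  have hX : {t | ∃ s ∈ teamRestrict X B, EqOn s t {n | n ∉ ys}} = teamRestrict X B := by
    ext t
    constructor
    · rintro ⟨s, ⟨u, hu, hus⟩, hst⟩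
      exact ⟨u, hu, fun n hn => (hus hn).trans (congrArg Subtype.val (hst hn.2))⟩
    · exact fun ht => ⟨t, ht, eqOn_refl t _⟩
  refine ⟨M.restrict B, ⟨⟨a, mem_insert _ _⟩⟩, hB.to_subtype, (tSat_foldr_ex _ _ xs _).2
    ⟨teamRestrict X B, ⟨fun s _ => ?_, fun t _ => ⟨t, mem_univ _, eqOn_refl t _⟩⟩,
      (tSat_foldr_all _ _ ys _).2 ((congrArg _ hX).mpr (TSat.restrict hga M B hθ hθX))⟩⟩
  classical
  let t : ℕ → B := fun n => if hn : n ∈ xs then ⟨w n, Or.inr ⟨n, hn, rfl⟩⟩ else s n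
  refine ⟨t, ⟨w, hw, fun n hn => ?_⟩, fun n hn => ?_⟩
  · exact (congrArg Subtype.val (dif_pos hn.1 : t n = _)).symm
  · exact (dif_neg hn : t n = s n).symm
end

section
/- If 𝔄 is a striped and gridlike structure over the vocabulary {V, H, C, U, P, Q}, then there exists a homomorphism from the grid 𝔊 = (ℕ², V_𝔊, H_𝔊) into the {V,H}-reduct of 𝔄, i.e., a function h : ℕ² → A such that for all u, w ∈ ℕ²: V_𝔊(u,w) implies V(h(u), h(w)) and H_𝔊(u,w) implies H(h(u), h(w)). -/
/-- The vertical successor relation of the grid ℕ²: `V((i,j),(i,j+1))`. -/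
def gridV : ℕ × ℕ → ℕ × ℕ → Prop := fun u w => w.1 = u.1 ∧ w.2 = u.2 + 1

/-- The horizontal successor relation of the grid ℕ²: `H((i,j),(i+1,j))`. -/
def gridH : ℕ × ℕ → ℕ × ℕ → Prop := fun u w => w.1 = u.1 + 1 ∧ w.2 = u.2

/-- A `{V,H}`-structure `(A, V, H)` is gridlike if `V` and `H` are serial and
whenever `V(a,b)`, `H(b,c)`, `H(a,b')`, `V(b',c')`, then `c = c'`. -/
def Gridlike {A : Type} (V H : A → A → Prop) : Prop :=
  (∀ a, ∃ b, V a b) ∧ (∀ a, ∃ b, H a b) ∧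
  (∀ a b c b' c', V a b → H b c → H a b' → V b' c' → c = c')

/-- A `{V,H,C,U,P,Q}`-structure is striped and gridlike if its `{V,H}`-reduct
is gridlike, the extensions of `P` and `Q` are distinct singletons, the
extension of `U` is their union, and `C` creates stripes: `H(a,b)` implies
`(C(a) ⇔ C(b))` and `V(a,b)` implies `(C(a) ⇔ ¬C(b))`. -/
def StripedGridlike {A : Type} (V H : A → A → Prop) (C U P Q : Set A) : Prop :=
  Gridlike V H ∧
  (∃ p, P = {p}) ∧ (∃ q, Q = {q}) ∧ P ≠ Q ∧ U = P ∪ Q ∧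
  (∀ a b, H a b → (a ∈ C ↔ b ∈ C)) ∧
  (∀ a b, V a b → (a ∈ C ↔ b ∉ C))

/-- Lemma 15 of the paper: if `𝔄` is striped and gridlike,
then there is a homomorphism from the grid `(ℕ², gridV, gridH)` into the
`{V,H}`-reduct of `𝔄`. -/
theorem striped_gridlike_grid_hom {A : Type} (V H : A → A → Prop)
    (C U P Q : Set A) (h : StripedGridlike V H C U P Q) :
    ∃ f : ℕ × ℕ → A,
      (∀ u w, gridV u w → V (f u) (f w)) ∧
      (∀ u w, gridH u w → H (f u) (f w)) := by
  obtain ⟨⟨hV, hH, hVH⟩, ⟨p, -⟩, -⟩ := h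
  choose v hv using hV
  choose g hg using hH
  have comm : Function.Commute g v := fun a => hVH _ _ _ _ _ (hv a) (hg _) (hg a) (hv _)
  refine ⟨fun u => v^[u.2] (g^[u.1] p), ?_, ?_⟩
  · rintro ⟨i, j⟩ ⟨k, l⟩ ⟨hk, hl⟩
    dsimp only at hk hl ⊢
    rw [hk, hl]
    simpa only [Function.iterate_succ_apply'] using hv (v^[j] (g^[i] p))
  · rintro ⟨i, j⟩ ⟨k, l⟩ ⟨hk, hl⟩
    dsimp only at hk hl ⊢
    rw [hk, hl]
    simpa only [Function.iterate_succ_apply', ← (comm.iterate_right j).eq] using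
      hg (v^[j] (g^[i] p))
end

section
/- Let T be a finite nonempty set of tiles. The grid 𝔊 is not T-tilable if and only if for every striped gridlike structure 𝔄, the {V,H}-reduct of 𝔄 is not T-tilable. -/
/-- A tile type is a function `t : {0,1,2,3} → ℕ`; `t 0` is the top, `t 1` the
right, `t 2` the bottom and `t 3` the left colour. A `{V,H}`-structure is
`T`-tilable (for a finite set `T` of tiles) if it has an expansion by unary
predicates `P t` (`t ∈ T`) such that every point is in exactly one `P t`
(`t ∈ T`), horizontally adjacent tiles match in their right/left colours and
vertically adjacent tiles match in their top/bottom colours. -/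
def Tilable {A : Type} (V H : A → A → Prop) (T : Finset (Fin 4 → ℕ)) : Prop :=
  ∃ P : (Fin 4 → ℕ) → Set A,
    (∀ a : A, ∃! t, t ∈ T ∧ a ∈ P t) ∧
    (∀ u v : A, ∀ t s : Fin 4 → ℕ, t ∈ T → s ∈ T →
      H u v → u ∈ P t → v ∈ P s → t 1 = s 3) ∧
    (∀ u v : A, ∀ t s : Fin 4 → ℕ, t ∈ T → s ∈ T →
      V u v → u ∈ P t → v ∈ P s → t 0 = s 2)

/-- Tilings pull back along homomorphisms. -/
theorem Tilable.comap {A B : Type} {V H : A → A → Prop} {V' H' : B → B → Prop}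
    {T : Finset (Fin 4 → ℕ)} (h : Tilable V' H' T) (f : A → B)
    (hV : ∀ a b, V a b → V' (f a) (f b)) (hH : ∀ a b, H a b → H' (f a) (f b)) :
    Tilable V H T := by
  obtain ⟨P, hP, hPH, hPV⟩ := h
  exact ⟨fun t => f ⁻¹' P t, fun a => hP (f a),
    fun u v t s ht hs huv => hPH (f u) (f v) t s ht hs (hH u v huv),
    fun u v t s ht hs huv => hPV (f u) (f v) t s ht hs (hV u v huv)⟩

/-- The grid maps homomorphically into every nonempty gridlike structure. -/
theorem Gridlike.exists_hom_grid {A : Type} [Nonempty A] {V H : A → A → Prop}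
    (h : Gridlike V H) :
    ∃ φ : ℕ × ℕ → A, (∀ u w, gridV u w → V (φ u) (φ w)) ∧
      ∀ u w, gridH u w → H (φ u) (φ w) := by
  obtain ⟨hV, hH, hcomm⟩ := h
  choose f hf using hV
  choose g hg using hH
  have hfg : Function.Commute f g := fun a =>
    (hcomm a (f a) (g (f a)) (g a) (f (g a)) (hf a) (hg _) (hg a) (hf _)).symm
  obtain ⟨a⟩ := ‹Nonempty A›
  refine ⟨fun u => f^[u.2] (g^[u.1] a), ?_, ?_⟩
  · rintro u w ⟨h₁, h₂⟩
    simpa only [h₁, h₂, Function.iterate_succ_apply'] using hf _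
  · rintro u w ⟨h₁, h₂⟩
    simpa only [h₁, h₂, Function.iterate_succ_apply', (hfg.iterate_left u.2).eq] using hg _

theorem gridlike_grid : Gridlike gridV gridH := by
  refine ⟨fun a => ⟨(a.1, a.2 + 1), rfl, rfl⟩, fun a => ⟨(a.1 + 1, a.2), rfl, rfl⟩, ?_⟩
  rintro a b c b' c' ⟨h₁, h₂⟩ ⟨h₃, h₄⟩ ⟨h₅, h₆⟩ ⟨h₇, h₈⟩
  ext <;> omega

/-- The grid, striped by the parity of the rows, is a striped gridlike structure. -/
theorem stripedGridlike_grid :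
    StripedGridlike gridV gridH {u | Even u.2} ({(0, 0)} ∪ {(1, 0)}) {(0, 0)} {(1, 0)} := by
  refine ⟨gridlike_grid, ⟨_, rfl⟩, ⟨_, rfl⟩, by simp, rfl, ?_, ?_⟩
  · rintro a b ⟨-, h⟩
    simp [h]
  · rintro a b ⟨-, h⟩
    simp [h, Nat.even_add_one]

/-- Lemma 16 of the paper: for a finite nonempty set `T` of
tiles, the grid is not `T`-tilable iff the `{V,H}`-reduct of every striped
gridlike structure is not `T`-tilable. -/
theorem grid_nontilable_iff_striped_gridlike_nontilable
    (T : Finset (Fin 4 → ℕ)) (hT : T.Nonempty) :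
    ¬ Tilable gridV gridH T ↔
      ∀ (A : Type) (V H : A → A → Prop) (C U P Q : Set A),
        StripedGridlike V H C U P Q → ¬ Tilable V H T := by
  constructor
  · rintro hgrid A V H C U P Q ⟨hgl, ⟨p, -⟩, -⟩ htil
    have : Nonempty A := ⟨p⟩
    obtain ⟨φ, hφV, hφH⟩ := hgl.exists_hom_grid
    exact hgrid (htil.comap φ hφV hφH)
  · exact fun h => h _ _ _ _ _ _ _ stripedGridlike_grid
end
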